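/- arXiv:cs/0603048 — 2 statements merged into one kernel-verified Lean document; each statement's English description precedes it below -/
import Mathlib

section
/- Let H be a homogeneous relation on a finite set V that fulfills axiom A1. Then the family F_H of homogeneous sets of H is partitive: it contains V and all singletons, and for all overlapping A, B ∈ F_H, the sets A ∩ B, A ∪ B, A \ B and the symmetric difference A Δ B belong to F_H. -/
/-- Two sets overlap: their intersection and both differences are nonempty. -/
def Overlaps {V : Type*} (A B : Set V) : Prop :=
  (A ∩ B).Nonempty ∧ (A \ B).Nonempty ∧ (B \ A).Nonempty

/-- `H` is a homogeneous relation: for each `s`, `H s · ·` is an equivalence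
relation on `V \ {s}` (symmetry, reflexivity on reflectless triples, transitivity). -/
def IsHomRel {V : Type*} (H : V → V → V → Prop) : Prop :=
  (∀ s x y : V, H s x y → H s y x) ∧
  (∀ s x : V, s ≠ x → H s x x) ∧
  (∀ s x y z : V, H s x y → H s y z → H s x z)

/-- `M` is a homogeneous set of `H`: nonempty and homogeneous w.r.t. every `s ∉ M`. -/
def IsHomSet {V : Type*} (H : V → V → V → Prop) (M : Set V) : Prop :=
  M.Nonempty ∧ ∀ s ∉ M, ∀ x ∈ M, ∀ y ∈ M, H s x y

/-- Axiom A1: `H(x|yz) ∧ H(y|xz) ⇒ H(z|xy)` on reflectless triples. -/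
def AxiomA1 {V : Type*} (H : V → V → V → Prop) : Prop :=
  ∀ x y z : V, x ≠ y → x ≠ z → y ≠ z → H x y z → H y x z → H z x y

section

variable {V : Type*} {H : V → V → V → Prop} {A B : Set V}

theorem IsHomSet.univ [Nonempty V] : IsHomSet H (Set.univ : Set V) :=
  ⟨Set.univ_nonempty, fun s hs => absurd (Set.mem_univ s) hs⟩

theorem IsHomSet.singleton (hH : IsHomRel H) (v : V) : IsHomSet H {v} := by
  refine ⟨Set.singleton_nonempty v, ?_⟩
  rintro s hs x rfl y rfl
  exact hH.2.1 s y hs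

theorem IsHomSet.inter (hA : IsHomSet H A) (hB : IsHomSet H B) (hAB : (A ∩ B).Nonempty) :
    IsHomSet H (A ∩ B) := by
  refine ⟨hAB, fun s hs x hx y hy => ?_⟩
  by_cases hsA : s ∈ A
  · exact hB.2 s (fun hsB => hs ⟨hsA, hsB⟩) x hx.2 y hy.2
  · exact hA.2 s hsA x hx.1 y hy.1

theorem IsHomSet.union (hH : IsHomRel H) (hA : IsHomSet H A) (hB : IsHomSet H B)
    (hAB : (A ∩ B).Nonempty) : IsHomSet H (A ∪ B) := by
  obtain ⟨c, hcA, hcB⟩ := hAB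
  refine ⟨⟨c, Or.inl hcA⟩, fun s hs x hx y hy => ?_⟩
  have key : ∀ z ∈ A ∪ B, H s z c := by
    rintro z (hz | hz)
    · exact hA.2 s (fun h => hs (Or.inl h)) z hz c hcA
    · exact hB.2 s (fun h => hs (Or.inr h)) z hz c hcB
  exact hH.2.2 s x c y (key x hx) (hH.1 s y c (key y hy))

/-- Under A1, an element of `A ∩ B` does not distinguish `A \ B` from `B \ A`. -/
theorem IsHomSet.rel_of_mem_sdiff (hax : AxiomA1 H) (hA : IsHomSet H A) (hB : IsHomSet H B)
    {s a b : V} (hs : s ∈ A ∩ B) (ha : a ∈ A \ B) (hb : b ∈ B \ A) : H s a b :=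
  hax a b s (ne_of_mem_of_not_mem ha.1 hb.2) (ne_of_mem_of_not_mem hs.2 ha.2).symm
    (ne_of_mem_of_not_mem hs.1 hb.2).symm (hB.2 a ha.2 b hb.1 s hs.2) (hA.2 b hb.2 a ha.1 s hs.1)

theorem IsHomSet.sdiff (hH : IsHomRel H) (hax : AxiomA1 H) (hA : IsHomSet H A)
    (hB : IsHomSet H B) (hAB : Overlaps A B) : IsHomSet H (A \ B) := by
  obtain ⟨-, hne, b, hb⟩ := hAB
  refine ⟨hne, fun s hs x hx y hy => ?_⟩
  by_cases hsA : s ∈ A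
  · have hsAB : s ∈ A ∩ B := ⟨hsA, by_contra fun h => hs ⟨hsA, h⟩⟩
    exact hH.2.2 s x b y (hA.rel_of_mem_sdiff hax hB hsAB hx hb)
      (hH.1 s y b (hA.rel_of_mem_sdiff hax hB hsAB hy hb))
  · exact hA.2 s hsA x hx.1 y hy.1

theorem IsHomSet.symmDiff (hH : IsHomRel H) (hax : AxiomA1 H) (hA : IsHomSet H A)
    (hB : IsHomSet H B) (hAB : Overlaps A B) : IsHomSet H ((A \ B) ∪ (B \ A)) := by
  have hBA : Overlaps B A := ⟨Set.inter_comm A B ▸ hAB.1, hAB.2.2, hAB.2.1⟩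
  refine ⟨hAB.2.1.inl, fun s hs x hx y hy => ?_⟩
  by_cases hsU : s ∈ A ∪ B
  · have hsAB : s ∈ A ∩ B := by
      simp only [Set.mem_union, Set.mem_sdiff, Set.mem_inter_iff] at *
      tauto
    rcases hx with hx | hx <;> rcases hy with hy | hy
    · exact (hA.sdiff hH hax hB hAB).2 s (fun h => hs (Or.inl h)) x hx y hy
    · exact hA.rel_of_mem_sdiff hax hB hsAB hx hy
    · exact hH.1 s y x (hA.rel_of_mem_sdiff hax hB hsAB hy hx)
    · exact (hB.sdiff hH hax hA hBA).2 s (fun h => hs (Or.inr h)) x hx y hy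
  · exact (hA.union hH hB hAB.1).2 s hsU x (hx.imp And.left And.left) y
      (hy.imp And.left And.left)

end

/-- If a homogeneous relation fulfills A1, its homogeneous sets form a partitive
family: it contains the ground set and all singletons, and is closed under
intersection, union, difference and symmetric difference of overlapping members. -/
theorem homSets_partitive {V : Type*} [Fintype V] [Nonempty V]
    (H : V → V → V → Prop) (hH : IsHomRel H) (hax : AxiomA1 H) :
    IsHomSet H (Set.univ : Set V) ∧ (∀ v : V, IsHomSet H {v}) ∧
    ∀ A B : Set V, IsHomSet H A → IsHomSet H B → Overlaps A B →
      IsHomSet H (A ∩ B) ∧ IsHomSet H (A ∪ B) ∧ IsHomSet H (A \ B) ∧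
        IsHomSet H ((A \ B) ∪ (B \ A)) := by
  refine ⟨IsHomSet.univ, IsHomSet.singleton hH, fun A B hA hB hAB => ?_⟩
  exact ⟨hA.inter hB hAB.1, hA.union hH hB hAB.1, hA.sdiff hH hax hB hAB,
    hA.symmDiff hH hax hB hAB⟩
end

section
/- Let H be a homogeneous relation on a finite set V and let x ∈ V. Then the inclusion-maximal homogeneous sets of H not containing x form a partition of V \ {x}: every element y ≠ x belongs to exactly one homogeneous set of H that does not contain x and is maximal for inclusion among homogeneous sets not containing x. -/
/-- Every singleton is a homogeneous set. -/
theorem IsHomRel.isHomSet_singleton {V : Type*} {H : V → V → V → Prop} (hH : IsHomRel H)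
    (y : V) : IsHomSet H {y} := by
  refine ⟨Set.singleton_nonempty y, ?_⟩
  rintro s hs _ rfl _ rfl
  exact hH.2.1 s _ hs

/-- A nonempty union of homogeneous sets with a common element is a homogeneous set. -/
theorem IsHomRel.isHomSet_sUnion {V : Type*} {H : V → V → V → Prop} (hH : IsHomRel H)
    {S : Set (Set V)} (hne : S.Nonempty) {y : V} (hS : ∀ M ∈ S, IsHomSet H M)
    (hy : ∀ M ∈ S, y ∈ M) : IsHomSet H (⋃₀ S) := by
  obtain ⟨M, hM⟩ := hne
  refine ⟨⟨y, M, hM, hy M hM⟩, ?_⟩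
  rintro s hs a ⟨A, hA, haA⟩ b ⟨B, hB, hbB⟩
  exact hH.2.2 s a y b
    ((hS A hA).2 s (fun h => hs ⟨A, hA, h⟩) a haA y (hy A hA))
    ((hS B hB).2 s (fun h => hs ⟨B, hB, h⟩) y (hy B hB) b hbB)

/-- The inclusion-maximal homogeneous sets of `H` not containing `x` form a
partition of `V \\ {x}`: every `y ≠ x` lies in exactly one homogeneous set not
containing `x` that is maximal among homogeneous sets not containing `x`. -/
theorem maximal_homSets_avoiding_partition {V : Type*} [Fintype V]
    (H : V → V → V → Prop) (hH : IsHomRel H) (x : V) :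
    ∀ y : V, y ≠ x →
      ∃! M : Set V, IsHomSet H M ∧ x ∉ M ∧ y ∈ M ∧
        ∀ N, IsHomSet H N → x ∉ N → M ⊆ N → N = M := by
  intro y hyx
  let S : Set (Set V) := {M | IsHomSet H M ∧ x ∉ M ∧ y ∈ M}
  have hsingle : {y} ∈ S := ⟨hH.isHomSet_singleton y, fun h => hyx h.symm, rfl⟩
  have hhom : IsHomSet H (⋃₀ S) :=
    hH.isHomSet_sUnion ⟨_, hsingle⟩ (fun M hM => hM.1) (fun M hM => hM.2.2)
  have hx : x ∉ ⋃₀ S := by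
    rintro ⟨M, hM, hxM⟩
    exact hM.2.1 hxM
  have hy : y ∈ ⋃₀ S := ⟨_, hsingle, rfl⟩
  refine ⟨⋃₀ S, ⟨hhom, hx, hy, fun N hN hxN hle => ?_⟩, ?_⟩
  · exact (Set.subset_sUnion_of_mem (show N ∈ S from ⟨hN, hxN, hle hy⟩)).antisymm hle
  · rintro M ⟨hM, hxM, hyM, hmax⟩
    exact (hmax _ hhom hx (Set.subset_sUnion_of_mem ⟨hM, hxM, hyM⟩)).symm
end
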